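/- Let P ⊆ ℝ² be a polygon such that the origin lies in the relative interior of an edge e of P, and let ν ∈ ℝ² be a nonzero normal vector to e (so that e ⊆ ν^⊥). Then for every x ∈ ℝ² that is not a scalar multiple of ν, vol₁(P ∩ x^⊥) = (1/2)·vol₁((P ∪ (−P)) ∩ x^⊥), while vol₁(P ∩ ν^⊥) > (1/2)·vol₁((P ∪ (−P)) ∩ ν^⊥). Consequently the radial function ρ_IP is discontinuous on ℝ² \ {0}, and IP is not convex. -/

import Mathlib

open MeasureTheory
open scoped RealInnerProductSpace

noncomputable section

/-- The hyperplane through the origin orthogonal to `x`. -/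
def perp {d : ℕ} (x : EuclideanSpace ℝ (Fin d)) : Set (EuclideanSpace ℝ (Fin d)) :=
  {y | ⟪x, y⟫ = 0}

/-- Radial function of the intersection body: `x ↦ vol_s(P ∩ x^⊥) / ‖x‖`,
where `vol_s` is the `s`-dimensional Hausdorff measure. -/
def radialFn {d : ℕ} (s : ℝ) (P : Set (EuclideanSpace ℝ (Fin d)))
    (x : EuclideanSpace ℝ (Fin d)) : ℝ :=
  (μH[s] (P ∩ perp x)).toReal / ‖x‖

/-- The intersection body `IP = {0} ∪ {x ≠ 0 : ρ_IP(x) ≥ 1}`. -/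
def ibody {d : ℕ} (s : ℝ) (P : Set (EuclideanSpace ℝ (Fin d))) :
    Set (EuclideanSpace ℝ (Fin d)) :=
  {0} ∪ {x | x ≠ 0 ∧ 1 ≤ radialFn s P x}

/-- A polytope: the convex hull of finitely many points. -/
def IsPolytope {d : ℕ} (P : Set (EuclideanSpace ℝ (Fin d))) : Prop :=
  ∃ S : Finset (EuclideanSpace ℝ (Fin d)), P = convexHull ℝ (S : Set (EuclideanSpace ℝ (Fin d)))

/-- `conv(a,b)` is an edge of `P`: a one-dimensional face (i.e. an extreme convex subset). -/
def IsEdgeOf {d : ℕ} (P : Set (EuclideanSpace ℝ (Fin d))) (a b : EuclideanSpace ℝ (Fin d)) :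
    Prop :=
  a ≠ b ∧ IsExtreme ℝ P (segment ℝ a b)


/-- If a set consists of multiples `c • p` with `c ∈ [a, b]`, its length is at most
`(b - a) * ‖p‖`. -/
lemma hausdorffMeasure_le_of_subset_smul {d : ℕ} {S : Set (EuclideanSpace ℝ (Fin d))}
    {p : EuclideanSpace ℝ (Fin d)} {a b : ℝ} (hab : a ≤ b)
    (hS : ∀ q ∈ S, ∃ c ∈ Set.Icc a b, q = c • p) :
    μH[(1 : ℝ)] S ≤ ENNReal.ofReal ((b - a) * ‖p‖) := by
  have hsub : S ⊆ segment ℝ (a • p) (b • p) := by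
    intro q hq
    obtain ⟨c, hc, rfl⟩ := hS q hq
    have himage := image_segment ℝ (LinearMap.toSpanSingleton ℝ _ p).toAffineMap a b
    rw [segment_eq_Icc hab] at himage
    simp only [LinearMap.coe_toAffineMap, LinearMap.toSpanSingleton_apply] at himage
    rw [← himage]
    exact ⟨c, hc, rfl⟩
  refine (measure_mono hsub).trans ?_
  rw [hausdorffMeasure_segment, edist_dist, dist_comm, dist_eq_norm, ← sub_smul, norm_smul,
    Real.norm_of_nonneg (sub_nonneg.2 hab)]

lemma measurableSet_perp {d : ℕ} (x : EuclideanSpace ℝ (Fin d)) : MeasurableSet (perp x) :=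
  (isClosed_eq (by fun_prop) continuous_const : IsClosed {y | ⟪x, y⟫ = 0}).measurableSet

lemma perp_smul {d : ℕ} {c : ℝ} (hc : c ≠ 0) (x : EuclideanSpace ℝ (Fin d)) :
    perp (c • x) = perp x := by
  ext y
  simp [perp, inner_smul_left, hc]

/-- In the plane, the orthogonal complement of a nonzero vector is spanned by any of its nonzero
elements. -/
lemma exists_eq_smul_of_mem_perp {x p q : EuclideanSpace ℝ (Fin 2)} (hx : x ≠ 0) (hp : p ≠ 0)
    (hxp : p ∈ perp x) (hxq : q ∈ perp x) : ∃ c : ℝ, q = c • p := by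
  simp only [perp, Set.mem_ofPred_eq, PiLp.inner_apply, Fin.sum_univ_two, RCLike.inner_apply,
    conj_trivial] at hxp hxq
  have hdet : p 0 * q 1 = p 1 * q 0 := by
    by_contra hne
    have hne' : p 0 * q 1 - p 1 * q 0 ≠ 0 := sub_ne_zero.2 hne
    apply hx
    ext i
    fin_cases i
    · refine (mul_eq_zero.1 (?_ : (p 0 * q 1 - p 1 * q 0) * x 0 = 0)).resolve_left hne'
      linear_combination q 1 * hxp - p 1 * hxq
    · refine (mul_eq_zero.1 (?_ : (p 0 * q 1 - p 1 * q 0) * x 1 = 0)).resolve_left hne'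
      linear_combination p 0 * hxq - q 0 * hxp
  have hpos : p 0 ^ 2 + p 1 ^ 2 ≠ 0 := by
    intro h
    apply hp
    ext i
    have h0 : p 0 = 0 := by nlinarith [sq_nonneg (p 0), sq_nonneg (p 1)]
    have h1 : p 1 = 0 := by nlinarith [sq_nonneg (p 0), sq_nonneg (p 1)]
    fin_cases i
    · exact h0
    · exact h1
  refine ⟨(p 0 * q 0 + p 1 * q 1) / (p 0 ^ 2 + p 1 ^ 2), ?_⟩
  ext i
  fin_cases i
  · simp only [Fin.zero_eta, PiLp.smul_apply, smul_eq_mul]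
    field_simp
    linear_combination - p 1 * hdet
  · simp only [Fin.mk_one, PiLp.smul_apply, smul_eq_mul]
    field_simp
    linear_combination p 0 * hdet

/-- Orthogonal complements of two non-parallel vectors in the plane meet only in `0`. -/
lemma eq_zero_of_mem_perp_of_mem_perp {ν x p : EuclideanSpace ℝ (Fin 2)} (hν : ν ≠ 0)
    (hx : ¬ ∃ c : ℝ, x = c • ν) (hxp : p ∈ perp x) (hνp : p ∈ perp ν) : p = 0 := by
  by_contra hp
  refine hx (exists_eq_smul_of_mem_perp hp hν ?_ ?_)
  · rwa [perp, Set.mem_ofPred_eq, real_inner_comm]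
  · rwa [perp, Set.mem_ofPred_eq, real_inner_comm]

/-- If `P` lies on one side of `ν^⊥`, the part of a different line `x^⊥` in `P` is contained in a
ray, so its length is bounded by the norm of its elements. -/
lemma hausdorffMeasure_inter_perp_le {P : Set (EuclideanSpace ℝ (Fin 2))}
    {ν x : EuclideanSpace ℝ (Fin 2)} (hν : ν ≠ 0)
    (hside : ∀ p ∈ P, ∀ q ∈ P, 0 ≤ ⟪ν, p⟫ * ⟪ν, q⟫)
    (hx : ¬ ∃ c : ℝ, x = c • ν) {r : ℝ} (hr : 0 ≤ r) (hP : ∀ p ∈ P ∩ perp x, ‖p‖ ≤ r) :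
    μH[(1 : ℝ)] (P ∩ perp x) ≤ ENNReal.ofReal r := by
  have hx0 : x ≠ 0 := fun h ↦ hx ⟨0, by simp [h]⟩
  by_cases h : ∃ p ∈ P ∩ perp x, p ≠ 0
  · obtain ⟨p, ⟨hpP, hpx⟩, hp⟩ := h
    have hp' : 0 < ‖p‖ := norm_pos_iff.2 hp
    have hνp : ⟪ν, p⟫ ≠ 0 := fun h ↦ hp (eq_zero_of_mem_perp_of_mem_perp hν hx hpx h)
    have hle := hausdorffMeasure_le_of_subset_smul (S := P ∩ perp x) (p := p)
      (a := 0) (b := r / ‖p‖) (by positivity) ?_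
    · rwa [sub_zero, div_mul_cancel₀ _ hp'.ne'] at hle
    · rintro q ⟨hqP, hqx⟩
      obtain ⟨c, rfl⟩ := exists_eq_smul_of_mem_perp hx0 hp hpx hqx
      have hc : 0 ≤ c := by
        have h1 := hside p hpP _ hqP
        rw [inner_smul_right] at h1
        have h2 : 0 < ⟪ν, p⟫ ^ 2 := by positivity
        nlinarith
      have hcr := hP _ ⟨hqP, hqx⟩
      rw [norm_smul, Real.norm_of_nonneg hc] at hcr
      exact ⟨c, ⟨hc, (le_div_iff₀ hp').2 hcr⟩, rfl⟩
  · push Not at h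
    have hle := hausdorffMeasure_le_of_subset_smul (S := P ∩ perp x) (p := 0)
      (a := 0) (b := 0) le_rfl fun q hq ↦ ⟨0, by simp, by simp [h q hq]⟩
    exact hle.trans (by simp)

/-- If `P` lies on one side of `ν^⊥`, symmetrizing doubles the length of the other sections. -/
lemma hausdorffMeasure_union_neg_inter_perp {P : Set (EuclideanSpace ℝ (Fin 2))}
    {ν x : EuclideanSpace ℝ (Fin 2)} (hν : ν ≠ 0) (hmeas : MeasurableSet P)
    (hside : ∀ p ∈ P, ∀ q ∈ P, 0 ≤ ⟪ν, p⟫ * ⟪ν, q⟫) (hx : ¬ ∃ c : ℝ, x = c • ν) :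
    μH[(1 : ℝ)] ((P ∪ -P) ∩ perp x) = 2 * μH[(1 : ℝ)] (P ∩ perp x) := by
  have hneg : -P ∩ perp x = -(P ∩ perp x) := by
    ext y
    simp [perp]
  have hnegm : μH[(1 : ℝ)] (-(P ∩ perp x)) = μH[(1 : ℝ)] (P ∩ perp x) := by
    rw [← Set.image_neg_eq_neg]
    exact (LinearIsometryEquiv.neg ℝ).isometry.hausdorffMeasure_image
      (Or.inl zero_le_one) _
  have hm : MeasurableSet (P ∩ perp x) := hmeas.inter (measurableSet_perp x)
  have hinter : μH[(1 : ℝ)] ((P ∩ perp x) ∩ -(P ∩ perp x)) = 0 := by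
    have hle := hausdorffMeasure_le_of_subset_smul
      (S := (P ∩ perp x) ∩ -(P ∩ perp x)) (p := 0) (a := 0) (b := 0) le_rfl ?_
    · simpa using hle
    · rintro q ⟨⟨hqP, hqx⟩, hqP', -⟩
      refine ⟨0, by simp, ?_⟩
      rw [smul_zero]
      refine eq_zero_of_mem_perp_of_mem_perp hν hx hqx ?_
      have h := hside q hqP _ hqP'
      rw [inner_neg_right] at h
      rw [perp, Set.mem_ofPred_eq]
      nlinarith
  rw [Set.union_inter_distrib_right, hneg]
  have h := measure_union_add_inter₀ (μ := μH[(1 : ℝ)]) (P ∩ perp x)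
    (t := -(P ∩ perp x)) hm.neg.nullMeasurableSet
  rw [hinter, add_zero, hnegm] at h
  rw [h, two_mul]

/-- Sections of a compact set by hyperplanes through the origin are upper semicontinuous: if all
points of `P ∩ ν^⊥` have norm less than `r`, so do those of `P ∩ x^⊥` for `x` near `ν`. -/
lemma eventually_norm_le_of_mem_inter_perp {d : ℕ} {P : Set (EuclideanSpace ℝ (Fin d))}
    (hP : IsCompact P) {ν : EuclideanSpace ℝ (Fin d)} {r : ℝ}
    (hr : ∀ p ∈ P ∩ perp ν, ‖p‖ < r) :
    ∀ᶠ x in nhds ν, ∀ p ∈ P ∩ perp x, ‖p‖ ≤ r := by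
  have hK : IsCompact (P ∩ {p | r ≤ ‖p‖}) :=
    hP.inter_right (isClosed_le continuous_const continuous_norm)
  have h : ∀ᶠ x in nhds ν, ∀ p ∈ P ∩ {p | r ≤ ‖p‖}, ⟪x, p⟫ ≠ 0 := by
    refine hK.eventually_forall_of_forall_eventually fun p hp ↦ ?_
    have hcont : Continuous fun z : EuclideanSpace ℝ (Fin d) × EuclideanSpace ℝ (Fin d) ↦
      ⟪z.1, z.2⟫ := by fun_prop
    refine hcont.continuousAt.eventually_ne fun h0 ↦ ?_
    exact (hr p ⟨hp.1, h0⟩).not_ge hp.2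
  filter_upwards [h] with x hx p hp
  by_contra! hlt
  exact hx p ⟨hp.1, hlt.le⟩ hp.2

/-- A line through the relative interior of an edge containing the edge meets `P` in that edge. -/
lemma inter_perp_eq_segment {P : Set (EuclideanSpace ℝ (Fin 2))}
    {A B ν : EuclideanSpace ℝ (Fin 2)} (hν : ν ≠ 0) (hedge : IsExtreme ℝ P (segment ℝ A B))
    (hnormal : segment ℝ A B ⊆ perp ν) (hA : A ≠ 0) {t : ℝ} (ht : 0 < t) (hB : B = -t • A) :
    P ∩ perp ν = segment ℝ A B := by
  have zero_mem : ∀ a b : ℝ, 0 < a → 0 < b →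
      (0 : EuclideanSpace ℝ (Fin 2)) ∈ openSegment ℝ (a • A) (-b • A) := by
    intro a b ha hb
    refine ⟨b / (a + b), a / (a + b), by positivity, by positivity, by field_simp; ring, ?_⟩
    rw [smul_smul, smul_smul, ← add_smul]
    convert zero_smul ℝ A
    ring
  have h0 : (0 : EuclideanSpace ℝ (Fin 2)) ∈ segment ℝ A B := by
    have h := zero_mem 1 t one_pos ht
    rw [one_smul, ← hB] at h
    exact openSegment_subset_segment ℝ _ _ h
  refine Set.Subset.antisymm ?_ fun p hp ↦ ⟨hedge.subset hp, hnormal hp⟩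
  rintro p ⟨hpP, hpν⟩
  obtain ⟨c, rfl⟩ := exists_eq_smul_of_mem_perp hν hA (hnormal (left_mem_segment ℝ A B)) hpν
  rcases lt_trichotomy c 0 with hc | rfl | hc
  · refine hedge.right_mem_of_mem_openSegment
      (hedge.subset (left_mem_segment ℝ A B)) hpP h0 ?_
    simpa using zero_mem 1 (-c) one_pos (neg_pos.2 hc)
  · simpa using h0
  · refine hedge.left_mem_of_mem_openSegment hpP
      (hedge.subset (right_mem_segment ℝ A B)) h0 ?_
    rw [hB]
    exact zero_mem c t hc ht

/-- A convex set whose section by `ν^⊥` is an extreme subset lies on one side of `ν^⊥`. -/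
lemma inner_mul_inner_nonneg_of_isExtreme {d : ℕ} {P : Set (EuclideanSpace ℝ (Fin d))}
    (hP : Convex ℝ P) {ν : EuclideanSpace ℝ (Fin d)} (hext : IsExtreme ℝ P (P ∩ perp ν)) :
    ∀ p ∈ P, ∀ q ∈ P, 0 ≤ ⟪ν, p⟫ * ⟪ν, q⟫ := by
  intro p hp q hq
  by_contra! hlt
  set a := ⟪ν, p⟫ with ha
  set b := ⟪ν, q⟫ with hb
  have ha0 : a ≠ 0 := by rintro h; simp [h] at hlt
  have hb0 : b ≠ 0 := by rintro h; simp [h] at hlt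
  have hsum : 0 < |a| + |b| := by positivity
  have hcancel : |b| * a + |a| * b = 0 := by
    rcases mul_neg_iff.1 hlt with ⟨h1, h2⟩ | ⟨h1, h2⟩
    · rw [abs_of_pos h1, abs_of_neg h2]; ring
    · rw [abs_of_neg h1, abs_of_pos h2]; ring
  have hr : (|b| / (|a| + |b|)) • p + (|a| / (|a| + |b|)) • q ∈ openSegment ℝ p q :=
    ⟨_, _, by positivity, by positivity, by field_simp; ring, rfl⟩
  refine ha0 (hext.left_mem_of_mem_openSegment hp hq ⟨?_, ?_⟩ hr).2
  · exact hP.openSegment_subset hp hq hr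
  · rw [perp, Set.mem_ofPred_eq, inner_add_right, inner_smul_right, inner_smul_right, ← ha, ← hb]
    field_simp
    linear_combination hcancel

/-- A set with nonempty interior has a point off the hyperplane `ν^⊥`. -/
lemma exists_mem_inner_ne_zero {d : ℕ} {P : Set (EuclideanSpace ℝ (Fin d))}
    (hP : (interior P).Nonempty) {ν : EuclideanSpace ℝ (Fin d)} (hν : ν ≠ 0) :
    ∃ p ∈ P, ⟪ν, p⟫ ≠ 0 := by
  by_contra! h
  obtain ⟨q, hq⟩ := hP
  have hcont : Continuous fun t : ℝ ↦ q + t • ν := by fun_prop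
  have hev : ∀ᶠ t in nhdsWithin (0 : ℝ) (Set.Ioi 0), q + t • ν ∈ interior P :=
    (hcont.continuousAt.eventually (isOpen_interior.mem_nhds (by simpa using hq))).filter_mono
      nhdsWithin_le_nhds
  obtain ⟨t, htP, ht⟩ := (hev.and self_mem_nhdsWithin).exists
  have h1 := h _ (interior_subset htP)
  rw [inner_add_right, h q (interior_subset hq), inner_smul_right, zero_add,
    real_inner_self_eq_norm_sq] at h1
  have : 0 < ‖ν‖ := norm_pos_iff.2 hν
  have ht' : (0 : ℝ) < t := ht
  have : 0 < t * ‖ν‖ ^ 2 := by positivity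
  linarith

/-- Turning a point of a bounded convex set by a right angle gives a point of the intersection
body, provided that the set contains the origin and lies on one side of a line through it. -/
lemma exists_mem_ibody_not_smul {P : Set (EuclideanSpace ℝ (Fin 2))} (hP : Convex ℝ P)
    (hbdd : Bornology.IsBounded P) (h0 : 0 ∈ P) {ν : EuclideanSpace ℝ (Fin 2)} (hν : ν ≠ 0)
    (hside : ∀ p ∈ P, ∀ q ∈ P, 0 ≤ ⟪ν, p⟫ * ⟪ν, q⟫) (hne : ∃ p ∈ P, ⟪ν, p⟫ ≠ 0) :
    ∃ y ∈ ibody 1 P, ¬ ∃ c : ℝ, y = c • ν := by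
  obtain ⟨p, hpP, hp⟩ := hne
  have hp0 : p ≠ 0 := by rintro rfl; simp at hp
  have hp' : 0 < ‖p‖ := norm_pos_iff.2 hp0
  set y : EuclideanSpace ℝ (Fin 2) := !₂[-p 1, p 0] with hy
  have hyp : ⟪y, p⟫ = 0 := by
    simp [hy, PiLp.inner_apply, Fin.sum_univ_two]
    ring
  have hnorm : ‖y‖ = ‖p‖ := by
    simp [hy, EuclideanSpace.norm_eq, Fin.sum_univ_two, add_comm]
  have hy0 : y ≠ 0 := norm_pos_iff.1 (hnorm ▸ hp')
  have hyν : ¬ ∃ c : ℝ, y = c • ν := by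
    rintro ⟨c, hc⟩
    rw [hc, real_inner_smul_left] at hyp
    rcases mul_eq_zero.1 hyp with h | h
    · exact hy0 (by rw [hc, h, zero_smul])
    · exact hp h
  refine ⟨y, Or.inr ⟨hy0, ?_⟩, hyν⟩
  obtain ⟨R, hR, hPR⟩ := hbdd.exists_pos_norm_le
  have hfin : μH[(1 : ℝ)] (P ∩ perp y) ≠ ⊤ := ne_top_of_le_ne_top ENNReal.ofReal_ne_top
    (hausdorffMeasure_inter_perp_le hν hside hyν hR.le fun q hq ↦ hPR q hq.1)
  have hsub : segment ℝ 0 p ⊆ P ∩ perp y := by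
    intro q hq
    refine ⟨hP.segment_subset h0 hpP hq, ?_⟩
    obtain ⟨a, b, -, -, -, rfl⟩ := hq
    simp [perp, inner_smul_right, hyp]
  have hle := measure_mono (μ := μH[(1 : ℝ)]) hsub
  rw [hausdorffMeasure_segment, edist_dist, dist_zero_left] at hle
  rw [radialFn, one_le_div (norm_pos_iff.2 hy0), hnorm]
  exact (ENNReal.ofReal_le_iff_le_toReal hfin).1 hle

/-- Points outside the line spanned by `ν` accumulate at `ν` along segments starting at `ν`. -/
lemma exists_lineMap_of_eventually {d : ℕ} {ν y : EuclideanSpace ℝ (Fin d)}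
    (hy : ¬ ∃ c : ℝ, y = c • ν) {p : EuclideanSpace ℝ (Fin d) → Prop}
    (hp : ∀ᶠ x in nhds ν, p x) :
    ∃ x ∈ segment ℝ ν y, (¬ ∃ c : ℝ, x = c • ν) ∧ p x := by
  have hcont : Continuous fun t : ℝ ↦ (1 - t) • ν + t • y := by fun_prop
  have hev : ∀ᶠ t in nhdsWithin (0 : ℝ) (Set.Ioi 0), p ((1 - t) • ν + t • y) :=
    (hcont.continuousAt.eventually (by simpa using hp)).filter_mono nhdsWithin_le_nhds
  obtain ⟨t, htp, ht0, ht1⟩ := (hev.and (Ioo_mem_nhdsGT (zero_lt_one' ℝ))).exists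
  refine ⟨_, ⟨1 - t, t, by linarith, ht0.le, by ring, rfl⟩, ?_, htp⟩
  rintro ⟨c, hc⟩
  refine hy ⟨t⁻¹ * (c - (1 - t)), ?_⟩
  rw [mul_smul, sub_smul, ← hc, add_sub_cancel_left, inv_smul_smul₀ ht0.ne']

/-- Let `P ⊆ ℝ²` be a polygon with the origin in the relative interior of an
edge `conv(A,B)` of `P`, and let `ν ≠ 0` be a normal vector of this edge. Then
`vol₁(P ∩ x^⊥) = ½ vol₁((P ∪ -P) ∩ x^⊥)` for every `x` which is not a multiple of `ν`, while
`vol₁(P ∩ ν^⊥) > ½ vol₁((P ∪ -P) ∩ ν^⊥)`; consequently `ρ_IP` is discontinuous on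
`ℝ² \ {0}` and `IP` is not convex. -/
theorem statement_12 (P : Set (EuclideanSpace ℝ (Fin 2)))
    (hpoly : IsPolytope P) (hfull : (interior P).Nonempty)
    (A B : EuclideanSpace ℝ (Fin 2)) (hedge : IsEdgeOf P A B)
    (h0 : (0 : EuclideanSpace ℝ (Fin 2)) ∈ openSegment ℝ A B)
    (ν : EuclideanSpace ℝ (Fin 2)) (hν : ν ≠ 0)
    (hnormal : segment ℝ A B ⊆ perp ν) :
    (∀ x : EuclideanSpace ℝ (Fin 2), (¬ ∃ c : ℝ, x = c • ν) →
      (μH[(1 : ℝ)] (P ∩ perp x)).toReal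
        = (1 / 2) * (μH[(1 : ℝ)] ((P ∪ -P) ∩ perp x)).toReal)
    ∧ (1 / 2) * (μH[(1 : ℝ)] ((P ∪ -P) ∩ perp ν)).toReal
        < (μH[(1 : ℝ)] (P ∩ perp ν)).toReal
    ∧ ¬ ContinuousOn (radialFn 1 P) {x | x ≠ 0}
    ∧ ¬ Convex ℝ (ibody 1 P) := by
  obtain ⟨S, rfl⟩ := hpoly
  set P := convexHull ℝ (S : Set (EuclideanSpace ℝ (Fin 2)))
  have hconv : Convex ℝ P := convex_convexHull ℝ _
  have hcomp : IsCompact P := S.finite_toSet.isCompact_convexHull ℝ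
  obtain ⟨hAB, hext⟩ := hedge
  have h0P : 0 ∈ P := hext.subset (openSegment_subset_segment ℝ _ _ h0)
  obtain ⟨t, ht, hB⟩ : ∃ t : ℝ, 0 < t ∧ B = -t • A := by
    obtain ⟨a, b, ha, hb, -, hsum⟩ := h0
    refine ⟨b⁻¹ * a, by positivity, ?_⟩
    rw [neg_smul, mul_smul, eq_neg_of_add_eq_zero_left hsum, smul_neg, neg_neg,
      inv_smul_smul₀ hb.ne']
  have hA : A ≠ 0 := by
    rintro rfl
    simp [hB] at hAB
  have hA' : 0 < ‖A‖ := norm_pos_iff.2 hA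
  have hsection := inter_perp_eq_segment hν hext hnormal hA ht hB
  have hside := inner_mul_inner_nonneg_of_isExtreme hconv (hsection ▸ hext)
  set L : ℝ := (1 + t) * ‖A‖ with hL
  set M : ℝ := max 1 t * ‖A‖ with hM
  have hM0 : 0 < M := by positivity
  have hML : M < L := by
    refine mul_lt_mul_of_pos_right (max_lt ?_ ?_) hA' <;> linarith
  have hμν : μH[(1 : ℝ)] (P ∩ perp ν) = ENNReal.ofReal L := by
    rw [hsection, hausdorffMeasure_segment, edist_dist, dist_eq_norm, hB, neg_smul,
      sub_neg_eq_add, hL, ← Real.norm_of_nonneg (by positivity : 0 ≤ 1 + t), ← norm_smul,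
      add_smul, one_smul]
  have hnorm : ∀ p ∈ P ∩ perp ν, ‖p‖ ≤ M := by
    rw [hsection]
    intro p hp
    rw [← mem_closedBall_zero_iff]
    refine (convex_closedBall 0 M).segment_subset ?_ ?_ hp
    · rw [mem_closedBall_zero_iff]
      exact le_mul_of_one_le_left hA'.le (le_max_left _ _)
    · rw [mem_closedBall_zero_iff, hB, norm_smul, norm_neg, Real.norm_of_nonneg ht.le]
      exact mul_le_mul_of_nonneg_right (le_max_right _ _) hA'.le
  have hunion : μH[(1 : ℝ)] ((P ∪ -P) ∩ perp ν) ≤ ENNReal.ofReal (2 * M) := by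
    have hle := hausdorffMeasure_le_of_subset_smul (S := (P ∪ -P) ∩ perp ν) (p := A)
      (a := -max 1 t) (b := max 1 t) (by linarith [le_max_left 1 t]) ?_
    · rwa [sub_neg_eq_add, ← two_mul, mul_assoc] at hle
    · rintro q ⟨hqP, hqν⟩
      obtain ⟨c, rfl⟩ := exists_eq_smul_of_mem_perp hν hA
        (hnormal (left_mem_segment ℝ A B)) hqν
      have hcM : ‖c • A‖ ≤ M := by
        rcases hqP with h | h
        · exact hnorm _ ⟨h, hqν⟩
        · rw [← norm_neg]
          exact hnorm _ ⟨h, by simpa [perp] using hqν⟩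
      rw [norm_smul, Real.norm_eq_abs] at hcM
      exact ⟨c, abs_le.1 (le_of_mul_le_mul_right hcM hA'), rfl⟩
  refine ⟨fun x hx ↦ ?_, ?_, ?_⟩
  · rw [hausdorffMeasure_union_neg_inter_perp hν hcomp.measurableSet hside hx,
      ENNReal.toReal_mul]
    simp
  · rw [hμν, ENNReal.toReal_ofReal (hM0.trans hML).le]
    have := ENNReal.toReal_le_of_le_ofReal (by positivity) hunion
    linarith
  have hν' : 0 < ‖ν‖ := norm_pos_iff.2 hν
  have hL0 : 0 < L := hM0.trans hML
  have hk : L / ‖ν‖ ≠ 0 := by positivity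
  set w : EuclideanSpace ℝ (Fin 2) := (L / ‖ν‖) • ν with hw
  have hwperp : perp w = perp ν := perp_smul hk ν
  have hwnorm : ‖w‖ = L := by
    rw [hw, norm_smul, Real.norm_of_nonneg (by positivity), div_mul_cancel₀ _ hν'.ne']
  have hw0 : w ≠ 0 := norm_pos_iff.1 (hwnorm ▸ hL0)
  have hwline : ∀ x, (¬ ∃ c : ℝ, x = c • w) → ¬ ∃ c : ℝ, x = c • ν := by
    rintro x hx ⟨c, rfl⟩
    exact hx ⟨c * (L / ‖ν‖)⁻¹, by rw [mul_smul, hw, inv_smul_smul₀ hk]⟩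
  have hwline' : ∀ x, (¬ ∃ c : ℝ, x = c • ν) → ¬ ∃ c : ℝ, x = c • w := by
    rintro x hx ⟨c, rfl⟩
    exact hx ⟨c * (L / ‖ν‖), by rw [mul_smul]⟩
  have hwrad : radialFn 1 P w = 1 := by
    rw [radialFn, hwperp, hμν, hwnorm, ENNReal.toReal_ofReal hL0.le, div_self hL0.ne']
  obtain ⟨r, hMr, hrL⟩ := exists_between hML
  have hr0 : 0 < r := hM0.trans hMr
  have hnear : ∀ᶠ x in nhds w, (¬ ∃ c : ℝ, x = c • w) →
      x ≠ 0 ∧ r < ‖x‖ ∧ radialFn 1 P x * ‖x‖ ≤ r := by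
    have h1 := eventually_norm_le_of_mem_inter_perp (ν := w) (r := r) hcomp
      (by rw [hwperp]; exact fun p hp ↦ (hnorm p hp).trans_lt hMr)
    have h2 : ∀ᶠ x in nhds w, r < ‖x‖ :=
      continuous_norm.continuousAt.eventually_const_lt (by simpa only [hwnorm] using hrL)
    filter_upwards [h1, h2] with x hx hrx hxw
    have hx' : 0 < ‖x‖ := hr0.trans hrx
    refine ⟨norm_pos_iff.1 hx', hrx, ?_⟩
    rw [radialFn, div_mul_cancel₀ _ hx'.ne']
    exact ENNReal.toReal_le_of_le_ofReal hr0.le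
      (hausdorffMeasure_inter_perp_le hν hside (hwline x hxw) hr0.le hx)
  obtain ⟨y, hyI, hyν⟩ := exists_mem_ibody_not_smul hconv hcomp.isBounded h0P hν hside
    (exists_mem_inner_ne_zero hfull hν)
  have hyw := hwline' y hyν
  constructor
  · intro hcont
    have hat : ContinuousAt (fun x ↦ radialFn 1 P x * ‖x‖) w :=
      (hcont.continuousAt (isOpen_ne.mem_nhds hw0)).mul continuous_norm.continuousAt
    have hgt : ∀ᶠ x in nhds w, r < radialFn 1 P x * ‖x‖ :=
      hat.eventually_const_lt (by simpa only [hwrad, hwnorm, one_mul] using hrL)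
    obtain ⟨x, -, hxw, hx, hxr⟩ := exists_lineMap_of_eventually hyw (hnear.and hgt)
    exact hxr.not_ge (hx hxw).2.2
  · intro hI
    obtain ⟨x, hxs, hxw, hx⟩ := exists_lineMap_of_eventually hyw hnear
    obtain ⟨hx0, hrx, hxr⟩ := hx hxw
    have hwI : w ∈ ibody 1 P := Or.inr ⟨hw0, hwrad.ge⟩
    rcases hI.segment_subset hwI hyI hxs with h | ⟨-, h⟩
    · exact hx0 h
    · exact (hrx.trans_le (le_mul_of_one_le_left (norm_nonneg x) h)).not_ge hxr
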